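/- arXiv:2001.08628 — 3 statements merged into one kernel-verified Lean document; each statement's English description precedes it below -/
import Mathlib

section
/- Let P be a finite nonempty poset with ground set X and, for each x ∈ X, let Q_x be a finite nonempty poset. Then ldim(Σ_{x∈P} Q_x) ≤ max{ ldim(P), max_{x∈X} dim(Q_x) }. -/
open scoped Classical

namespace PaperLD

/-- A partial linear extension of a poset `α`: a duplicate-free list whose
listing order extends the partial order on the elements it contains. -/
structure PLE (α : Type*) [PartialOrder α] where
  toList : List α
  nodup : toList.Nodup
  le_imp : ∀ i j : Fin toList.length, toList.get i ≤ toList.get j → i ≤ j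

/-- `x` occurs (weakly) before `y` in the partial linear extension `L`
(in particular both `x` and `y` belong to the ground set of `L`). -/
def PLE.Before {α : Type*} [PartialOrder α] (L : PLE α) (x y : α) : Prop :=
  ∃ i j : Fin L.toList.length, i ≤ j ∧ L.toList.get i = x ∧ L.toList.get j = y

/-- A family of partial linear extensions is a local realiser if, for every
ordered pair `(x, y)` with `x ≱ y`, some member lists `x` before `y`. -/
def IsLocalRealiser {α : Type*} [PartialOrder α] {ι : Type*} (F : ι → PLE α) : Prop :=
  ∀ x y : α, ¬ y ≤ x → ∃ i, (F i).Before x y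

/-- The multiplicity of `x` in a finite family of partial linear extensions:
the number of members whose ground set contains `x`. -/
noncomputable def mult {α : Type*} [PartialOrder α] {N : ℕ} (F : Fin N → PLE α) (x : α) : ℕ :=
  (Finset.univ.filter fun i => x ∈ (F i).toList).card

/-- The local dimension of a finite poset: the least `d` such that there is a
local realiser in which every element has multiplicity at most `d`. -/
noncomputable def ldim (α : Type*) [PartialOrder α] [Fintype α] : ℕ :=
  sInf {d | ∃ (N : ℕ) (F : Fin N → PLE α), IsLocalRealiser F ∧ ∀ x : α, mult F x ≤ d}

/-- The order dimension of a finite poset: the least `d` such that some family of `d`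
linear extensions (partial linear extensions containing every element) is a realiser. -/
noncomputable def odim (α : Type*) [PartialOrder α] [Fintype α] : ℕ :=
  sInf {d | ∃ F : Fin d → PLE α, (∀ i, ∀ x : α, x ∈ (F i).toList) ∧ IsLocalRealiser F}

/-- `BoolLayers n ℓ k` is the suborder of the Boolean lattice `Q(n)` induced by the
`ℓ`-th and `k`-th layers: all subsets of an `n`-set of cardinality `ℓ` or `k`,
ordered by inclusion. -/
abbrev BoolLayers (n ℓ k : ℕ) := {s : Finset (Fin n) // s.card = ℓ ∨ s.card = k}

end PaperLD

open PaperLD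

namespace PaperLD

section PartialLinearExtensions

variable {α : Type*} [PartialOrder α]

/-- A list in which no entry is below an earlier one is a partial linear extension. -/
def PLE.ofPairwise (l : List α) (h : l.Pairwise fun a b => ¬ b ≤ a) : PLE α where
  toList := l
  nodup := h.imp fun hab e => hab e.ge
  le_imp i j hij := le_of_not_gt fun hji => List.pairwise_iff_get.1 h j i hji hij

theorem PLE.pairwise_not_le (L : PLE α) : L.toList.Pairwise fun a b => ¬ b ≤ a :=
  List.pairwise_iff_get.2 fun i j hij hji => (L.le_imp j i hji).not_gt hij

theorem PLE.before_of_sublist {L : PLE α} {x y : α} (h : [x, y].Sublist L.toList) :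
    L.Before x y :=
  List.pairwise_iff_forall_sublist.1
    (List.pairwise_iff_get.2 fun i j hij => ⟨i, j, hij.le, rfl, rfl⟩ :
      L.toList.Pairwise L.Before) h

theorem PLE.Before.sublist {L : PLE α} {x y : α} (h : L.Before x y) (hxy : x ≠ y) :
    [x, y].Sublist L.toList := by
  obtain ⟨i, j, hij, rfl, rfl⟩ := h
  have hlt : i < j := hij.lt_of_ne fun e => hxy (congrArg _ e)
  exact List.pairwise_iff_get.1
    (List.pairwise_iff_forall_sublist.2 fun h => h :
      L.toList.Pairwise fun a b => [a, b].Sublist L.toList) i j hlt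

/-- The partial linear extension with a single element. -/
def PLE.single (x : α) : PLE α := .ofPairwise [x] (List.pairwise_singleton _ x)

/-- The partial linear extension with no elements. -/
def PLE.empty : PLE α := .ofPairwise [] .nil

/-- A linear order containing the partial order is listed by a full partial linear extension. -/
theorem PLE.exists_of_isLinearOrder [Fintype α] (s : α → α → Prop) [IsLinearOrder α s]
    (hs : ∀ a b, a ≤ b → s a b) :
    ∃ L : PLE α, (∀ a, a ∈ L.toList) ∧ ∀ a b, s a b → L.Before a b := by
  have hpw : (Finset.univ.sort s).Pairwise fun a b => ¬ b ≤ a :=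
    ((Finset.univ.pairwise_sort s).and (Finset.univ.sort_nodup s)).imp
      fun h hba => h.2 (antisymm h.1 (hs _ _ hba))
  have hmem : ∀ a, a ∈ Finset.univ.sort s := fun a => (Finset.mem_sort s).2 (Finset.mem_univ a)
  refine ⟨.ofPairwise _ hpw, hmem, fun a b hab => ?_⟩
  obtain ⟨i, rfl⟩ := List.mem_iff_get.1 (hmem a)
  obtain ⟨j, rfl⟩ := List.mem_iff_get.1 (hmem b)
  refine ⟨i, j, le_of_not_gt fun hji => ?_, rfl, rfl⟩
  have hsji := List.pairwise_iff_get.1 (Finset.univ.pairwise_sort s) j i hji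
  exact hji.ne ((Finset.univ.sort_nodup s).injective_get (antisymm hsji hab))

theorem PLE.exists_full [Fintype α] : ∃ L : PLE α, ∀ a, a ∈ L.toList := by
  obtain ⟨s, hs, hle⟩ := extend_partialOrder ((· ≤ ·) : α → α → Prop)
  obtain ⟨L, hL, -⟩ := PLE.exists_of_isLinearOrder s hle
  exact ⟨L, hL⟩

/-- Any `x ≱ y` can be listed in the order `x, y` by some linear extension. -/
theorem PLE.exists_full_before [Fintype α] {x y : α} (hxy : ¬ y ≤ x) :
    ∃ L : PLE α, (∀ a, a ∈ L.toList) ∧ L.Before x y := by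
  let r : α → α → Prop := fun a b => a ≤ b ∨ (a ≤ x ∧ y ≤ b)
  have : IsPartialOrder α r :=
    { refl := fun a => .inl le_rfl
      trans := by
        rintro a b c (hab | ⟨hax, hyb⟩) (hbc | ⟨hbx, hyc⟩)
        · exact .inl (hab.trans hbc)
        · exact .inr ⟨hab.trans hbx, hyc⟩
        · exact .inr ⟨hax, hyb.trans hbc⟩
        · exact .inr ⟨hax, hyc⟩
      antisymm := by
        rintro a b (hab | ⟨hax, hyb⟩) (hba | ⟨hbx, hya⟩)
        · exact hab.antisymm hba
        · exact (hxy (hya.trans (hab.trans hbx))).elim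
        · exact (hxy (hyb.trans (hba.trans hax))).elim
        · exact (hxy (hyb.trans hbx)).elim }
  obtain ⟨s, hs, hle⟩ := extend_partialOrder r
  obtain ⟨L, hL, hb⟩ := PLE.exists_of_isLinearOrder s fun a b h => hle a b (.inl h)
  exact ⟨L, hL, hb x y (hle x y (.inr ⟨le_rfl, le_rfl⟩))⟩

theorem IsLocalRealiser.comp_surjective {ι κ : Type*} {F : ι → PLE α} (hF : IsLocalRealiser F)
    {f : κ → ι} (hf : f.Surjective) : IsLocalRealiser (F ∘ f) := fun x y hxy => by
  obtain ⟨i, hi⟩ := hF x y hxy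
  obtain ⟨k, rfl⟩ := hf i
  exact ⟨k, hi⟩

variable (α) in
/-- The order dimension is attained by some realiser. -/
theorem exists_realiser_odim [Fintype α] :
    ∃ F : Fin (odim α) → PLE α, (∀ i, ∀ x : α, x ∈ (F i).toList) ∧ IsLocalRealiser F := by
  refine Nat.sInf_mem (s := {d | ∃ F : Fin d → PLE α, (∀ i, ∀ x : α, x ∈ (F i).toList) ∧
    IsLocalRealiser F}) ?_
  choose F hF using fun p : {p : α × α // ¬ p.2 ≤ p.1} => PLE.exists_full_before p.2
  let e := Fintype.equivFin {p : α × α // ¬ p.2 ≤ p.1}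
  exact ⟨_, F ∘ e.symm, fun i => (hF _).1, IsLocalRealiser.comp_surjective
    (fun x y hxy => ⟨⟨(x, y), hxy⟩, (hF _).2⟩) e.symm.surjective⟩

variable (α) in
/-- The local dimension is attained by some local realiser. -/
theorem exists_localRealiser_ldim [Fintype α] :
    ∃ (N : ℕ) (F : Fin N → PLE α), IsLocalRealiser F ∧ ∀ x : α, mult F x ≤ ldim α := by
  refine Nat.sInf_mem (s := {d | ∃ (N : ℕ) (F : Fin N → PLE α), IsLocalRealiser F ∧
    ∀ x : α, mult F x ≤ d}) ?_
  obtain ⟨F, -, hF⟩ := exists_realiser_odim α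
  exact ⟨odim α, odim α, F, hF, fun x => (Finset.card_le_univ _).trans_eq (Fintype.card_fin _)⟩

/-- The multiplicity of `x` is at most `d` exactly if the members containing `x` can be
injectively labelled by numbers below `d`. -/
theorem mult_le_iff {N d : ℕ} {F : Fin N → PLE α} {x : α} :
    mult F x ≤ d ↔ ∃ f : Fin N → ℕ, Set.MapsTo f {i | x ∈ (F i).toList} (Set.Iio d) ∧
      Set.InjOn f {i | x ∈ (F i).toList} := by
  constructor
  · intro h
    have hcard : Set.encard {i | x ∈ (F i).toList} ≤ Set.encard (Set.Iio d) := by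
      rw [mult, ← Set.ncard_coe_finset, Finset.coe_filter] at h
      rw [← Set.Finite.cast_ncard_eq (Set.toFinite _), ← Set.Finite.cast_ncard_eq (Set.toFinite _)]
      have hIio : (Set.Iio d).ncard = d := by simp [Set.ncard_eq_toFinset_card']
      simpa only [Nat.cast_le, hIio, Finset.mem_univ, true_and] using h
    obtain ⟨f, hf, hinj⟩ := (Set.toFinite _).exists_injOn_of_encard_le hcard
    exact ⟨f, hf, hinj⟩
  · rintro ⟨f, hf, hinj⟩
    refine (Finset.card_le_card_of_injOn (t := Finset.range d) f ?_ ?_).trans_eq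
      (Finset.card_range d)
    · simpa using hf
    · simpa using hinj

theorem ldim_le_of_isLocalRealiser [Fintype α] {ι : Type*} [Fintype ι] {F : ι → PLE α} {d : ℕ}
    (hF : IsLocalRealiser F)
    (hd : ∀ x, ∃ f : ι → ℕ, Set.MapsTo f {i | x ∈ (F i).toList} (Set.Iio d) ∧
      Set.InjOn f {i | x ∈ (F i).toList}) :
    ldim α ≤ d := by
  let e := Fintype.equivFin ι
  refine Nat.sInf_le ⟨_, F ∘ e.symm, hF.comp_surjective e.symm.surjective, fun x => ?_⟩
  obtain ⟨f, hf, hinj⟩ := hd x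
  exact mult_le_iff.2 ⟨f ∘ e.symm, fun i hi => hf hi,
    fun i hi j hj h => e.symm.injective (hinj hi hj h)⟩

/-- A realiser by linear extensions may be padded to any larger size. -/
theorem exists_realiser_of_odim_le [Fintype α] {d : ℕ} (hd : odim α ≤ d) :
    ∃ G : ℕ → PLE α, (∀ k x, x ∈ (G k).toList) ∧
      ∀ x y : α, ¬ y ≤ x → ∃ k < d, (G k).Before x y := by
  obtain ⟨F, hfull, hF⟩ := exists_realiser_odim α
  obtain ⟨L, hL⟩ := PLE.exists_full (α := α)
  refine ⟨fun k => if h : k < odim α then F ⟨k, h⟩ else L, fun k x => ?_, fun x y hxy => ?_⟩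
  · dsimp only
    split
    exacts [hfull _ x, hL x]
  · obtain ⟨k, hk⟩ := hF x y hxy
    exact ⟨k, k.2.trans_le hd, by simpa using hk⟩

end PartialLinearExtensions

section LexicographicSum

variable {α : Type*} [PartialOrder α] {Q : α → Type*} [∀ x, PartialOrder (Q x)]

/-- Replace every entry `x` of a partial linear extension by a partial linear extension
of `Q x`. -/
def PLE.lexSum (L : PLE α) (g : ∀ x, PLE (Q x)) : PLE (Σₗ x, Q x) :=
  .ofPairwise (L.toList.flatMap fun x => (g x).toList.map fun y => toLex ⟨x, y⟩) <| by
    refine List.pairwise_flatMap.2 ⟨fun x _ => List.pairwise_map.2 ?_, ?_⟩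
    · refine (g x).pairwise_not_le.imp fun {a b} hab h => ?_
      rcases h with ⟨_, _, h⟩ | ⟨_, _, h⟩
      exacts [lt_irrefl _ h, hab h]
    · refine L.pairwise_not_le.imp fun {x z} hxz => ?_
      simp only [List.mem_map]
      rintro _ ⟨a, -, rfl⟩ _ ⟨b, -, rfl⟩ h
      rcases h with ⟨_, _, h⟩ | ⟨_, _, h⟩
      exacts [hxz h.le, hxz le_rfl]

theorem PLE.mem_lexSum {L : PLE α} {g : ∀ x, PLE (Q x)} {x : α} {y : Q x} :
    (toLex ⟨x, y⟩ : Σₗ x, Q x) ∈ (L.lexSum g).toList ↔ x ∈ L.toList ∧ y ∈ (g x).toList := by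
  change _ ∈ List.flatMap _ _ ↔ _
  simp only [List.mem_flatMap, List.mem_map]
  constructor
  · rintro ⟨z, hz, w, hw, h⟩
    cases h
    exact ⟨hz, hw⟩
  · rintro ⟨hx, hy⟩
    exact ⟨x, hx, y, hy, rfl⟩

theorem PLE.lexSum_before_of_before {L : PLE α} {g : ∀ x, PLE (Q x)} {x z : α} {y : Q x} {w : Q z}
    (h : L.Before x z) (hxz : x ≠ z) (hy : y ∈ (g x).toList) (hw : w ∈ (g z).toList) :
    (L.lexSum g).Before (toLex ⟨x, y⟩) (toLex ⟨z, w⟩) := by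
  refine PLE.before_of_sublist (List.Sublist.trans ?_ ((h.sublist hxz).flatMap _))
  simp only [List.flatMap_cons, List.flatMap_nil, List.append_nil]
  exact List.Sublist.append (l₁ := [_]) (r₁ := [_])
    (List.singleton_sublist.2 (List.mem_map_of_mem hy))
    (List.singleton_sublist.2 (List.mem_map_of_mem hw))

theorem PLE.lexSum_before_of_mem {L : PLE α} {g : ∀ x, PLE (Q x)} {x : α} {y w : Q x}
    (hx : x ∈ L.toList) (h : (g x).Before y w) (hyw : y ≠ w) :
    (L.lexSum g).Before (toLex ⟨x, y⟩) (toLex ⟨x, w⟩) := by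
  refine PLE.before_of_sublist
    (List.Sublist.trans ?_ ((List.singleton_sublist.2 hx).flatMap _))
  simp only [List.flatMap_cons, List.flatMap_nil, List.append_nil]
  exact (h.sublist hyw).map fun y => (toLex ⟨x, y⟩ : Σₗ x, Q x)

/-- If every summand has a realiser of size `d`, a local realiser of the index poset with
multiplicities at most `d` lifts to one of the lexicographic sum. -/
theorem ldim_lexSum_le [Fintype α] [Fintype (Σₗ x, Q x)] {N d : ℕ} {F : Fin N → PLE α}
    (hF : IsLocalRealiser F) (hd : ∀ x, mult F x ≤ d) {G : ∀ x, ℕ → PLE (Q x)}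
    (hfull : ∀ x k y, y ∈ (G x k).toList)
    (hG : ∀ x, ∀ y w : Q x, ¬ w ≤ y → ∃ k < d, (G x k).Before y w) :
    ldim (Σₗ x, Q x) ≤ d := by
  choose e hmaps hinj using fun x => mult_le_iff.1 (hd x)
  let H : Fin N ⊕ (α × Fin d) → PLE (Σₗ x, Q x) := Sum.elim
    (fun i => (F i).lexSum fun x => G x (e x i))
    (fun p => if ∃ i, p.1 ∈ (F i).toList ∧ e p.1 i = p.2 then .empty
      else (PLE.single p.1).lexSum fun x => G x p.2)
  refine ldim_le_of_isLocalRealiser (F := H) ?_ ?_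
  · rintro ⟨x, y⟩ ⟨z, w⟩ hle
    by_cases hxz : x = z
    · subst hxz
      have hyw : ¬ w ≤ y := fun h => hle (Sigma.Lex.right _ _ h)
      have hne : y ≠ w := fun h => hyw h.ge
      obtain ⟨k, hk, hb⟩ := hG x y w hyw
      by_cases hex : ∃ i, x ∈ (F i).toList ∧ e x i = k
      · obtain ⟨i, hi, rfl⟩ := hex
        exact ⟨.inl i, PLE.lexSum_before_of_mem hi hb hne⟩
      · refine ⟨.inr (x, ⟨k, hk⟩), ?_⟩
        simp only [H, Sum.elim_inr, if_neg hex]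
        exact PLE.lexSum_before_of_mem (List.mem_singleton_self x) hb hne
    · obtain ⟨i, hi⟩ := hF x z fun h => hle (Sigma.Lex.left _ _ (h.lt_of_ne (Ne.symm hxz)))
      exact ⟨.inl i, PLE.lexSum_before_of_before hi hxz (hfull _ _ _) (hfull _ _ _)⟩
  · rintro ⟨x, y⟩
    have hl : ∀ i, toLex ⟨x, y⟩ ∈ (H (.inl i)).toList → x ∈ (F i).toList :=
      fun i hi => (PLE.mem_lexSum.1 hi).1
    have hr : ∀ p, toLex ⟨x, y⟩ ∈ (H (.inr p)).toList →
        x = p.1 ∧ ∀ i, x ∈ (F i).toList → e x i ≠ p.2 := by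
      rintro ⟨z, k⟩ hp
      simp only [H, Sum.elim_inr] at hp
      split_ifs at hp with hex
      · exact absurd hp List.not_mem_nil
      · obtain rfl := List.mem_singleton.1 (PLE.mem_lexSum.1 hp).1
        exact ⟨rfl, fun i hi he => hex ⟨i, hi, he⟩⟩
    refine ⟨Sum.elim (e x) fun p => p.2, ?_, ?_⟩
    · rintro (i | p) h
      exacts [hmaps x (hl i h), p.2.2]
    · rintro (i | p) h (j | q) h' heq <;> simp only [Sum.elim_inl, Sum.elim_inr] at heq
      · rw [hinj x (hl i h) (hl j h') heq]
      · exact ((hr q h').2 i (hl i h) heq).elim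
      · exact ((hr p h).2 j (hl j h') heq.symm).elim
      · rw [Prod.ext ((hr p h).1.symm.trans (hr q h').1) (Fin.ext heq)]

end LexicographicSum

end PaperLD

/-- The local dimension of a lexicographic sum is at most the maximum of the local
dimension of the indexing poset and the order dimensions of the summands. -/
theorem stmt2 (α : Type) [PartialOrder α] [Fintype α] [Nonempty α]
    (Q : α → Type) [∀ x, PartialOrder (Q x)] [∀ x, Fintype (Q x)] [∀ x, Nonempty (Q x)] :
    ldim (Σₗ x, Q x) ≤ max (ldim α) (Finset.univ.sup fun x => odim (Q x)) := by
  obtain ⟨N, F, hF, hmult⟩ := exists_localRealiser_ldim α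
  choose G hfull hG using fun x => exists_realiser_of_odim_le (α := Q x)
    ((Finset.le_sup (f := fun x => odim (Q x)) (Finset.mem_univ x)).trans
      (le_max_right (ldim α) _))
  exact ldim_lexSum_le hF (fun x => (hmult x).trans (le_max_left _ _)) hfull hG
end

section
/- For all integers t ≥ 2 and n ≥ 2, the average of dim_t(P) over all partial orders P on the set {1, …, n} (each partial order taken with equal weight) is at least ⌊n²/4⌋ / (n · log t) − ⌈log_t n⌉ / n. In particular, for t = 2, the average 2-dimension of a uniformly random partial order on {1, …, n} is at least ⌊n²/4⌋ / n − ⌈log n⌉ / n. -/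
open scoped Classical

open PaperLD

namespace PaperLD

/-- The partial order on `α` determined by a relation `r` that is a partial order. -/
def toPO {α : Type*} (r : α → α → Prop) (h : IsPartialOrder α r) : PartialOrder α where
  le := r
  le_refl := h.refl
  le_trans := h.trans
  le_antisymm := h.antisymm

/-- The `t`-dimension of a poset: the least `d` such that the poset order-embeds into a
product of `d` chains each of cardinality `t`. -/
noncomputable def tdim (t : ℕ) (α : Type*) [PartialOrder α] : ℕ :=
  sInf {d | Nonempty (α ↪o (Fin d → Fin t))}

/-- The `t`-dimension of the poset `({1, …, n}, r)`. -/
noncomputable def tdimRel (t n : ℕ) (r : Fin n → Fin n → Prop)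
    (h : IsPartialOrder (Fin n) r) : ℕ :=
  @tdim t (Fin n) (toPO r h)

end PaperLD

namespace PaperLD

/-- Jensen's inequality for `exp`: an upper bound on an exponential sum bounds the mean of the
exponents from below. -/
theorem log_card_sub_log_le_mul_mean {ι : Type*} [Fintype ι] [Nonempty ι] (x : ι → ℝ) (a m : ℝ)
    (h : ∑ i, Real.exp (-(a * x i)) ≤ m) :
    Real.log (Fintype.card ι) - Real.log m ≤ a * ((∑ i, x i) / Fintype.card ι) := by
  set c : ℝ := (∑ i, x i) / Fintype.card ι with hc
  have hN : (0 : ℝ) < Fintype.card ι := by exact_mod_cast Fintype.card_pos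
  have hsum : ∑ i, x i = c * Fintype.card ι := by rw [hc]; field_simp
  have key : (Fintype.card ι : ℝ) ≤ Real.exp (a * c) * m := by
    calc (Fintype.card ι : ℝ) = ∑ i, (a * c - a * x i + 1) := by
          rw [Finset.sum_add_distrib, Finset.sum_sub_distrib, ← Finset.mul_sum _ x, hsum]
          simp only [Finset.sum_const, Finset.card_univ, nsmul_eq_mul]
          ring
      _ ≤ ∑ i, Real.exp (a * c - a * x i) :=
          Finset.sum_le_sum fun i _ => Real.add_one_le_exp _
      _ = Real.exp (a * c) * ∑ i, Real.exp (-(a * x i)) := by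
          rw [Finset.mul_sum]
          exact Finset.sum_congr rfl fun i _ => by rw [← Real.exp_add, sub_eq_add_neg]
      _ ≤ Real.exp (a * c) * m := by gcongr
  have hm : 0 < m := pos_of_mul_pos_right (hN.trans_le key) (Real.exp_pos _).le
  have := Real.log_le_log hN key
  rw [Real.log_mul (Real.exp_pos _).ne' hm.ne', Real.log_exp] at this
  linarith

/-- A poset embeds into a power of a chain with at least two elements, by sending each
element to the indicator function of its principal down-set. -/
theorem nonempty_orderEmbedding_chain_pow {t : ℕ} (ht : 2 ≤ t) (α : Type*) [PartialOrder α] :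
    Nonempty (α ↪o (α → Fin t)) := by
  let f : α → α → Fin t := fun x z => if z ≤ x then ⟨1, by omega⟩ else ⟨0, by omega⟩
  have hf : ∀ x y, f x ≤ f y ↔ x ≤ y := by
    refine fun x y => ⟨fun h => ?_, fun h z => ?_⟩
    · by_contra hxy
      have := h x
      simp [f, hxy, Fin.le_def] at this
    · by_cases hz : z ≤ x
      · simp [f, hz, hz.trans h]
      · simp [f, hz, Fin.le_def]
  exact ⟨OrderEmbedding.ofMapLEIff f hf⟩

theorem exists_embedding_tdim {t : ℕ} {α : Type*} [PartialOrder α]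
    (h : ∃ d, Nonempty (α ↪o (Fin d → Fin t))) :
    ∃ f : α → Fin (tdim t α) → Fin t, ∀ x y, f x ≤ f y ↔ x ≤ y := by
  obtain ⟨e⟩ : Nonempty (α ↪o (Fin (tdim t α) → Fin t)) := Nat.sInf_mem h
  exact ⟨e, fun x y => e.le_iff_le⟩

theorem tdimRel_le {t n : ℕ} (ht : 2 ≤ t) (r : Fin n → Fin n → Prop)
    (h : IsPartialOrder (Fin n) r) : tdimRel t n r h ≤ n :=
  Nat.sInf_le (@nonempty_orderEmbedding_chain_pow t ht (Fin n) (toPO r h))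

theorem exists_embedding_tdimRel {t n : ℕ} (ht : 2 ≤ t) (r : Fin n → Fin n → Prop)
    (h : IsPartialOrder (Fin n) r) :
    ∃ f : Fin n → Fin (tdimRel t n r h) → Fin t, ∀ x y, f x ≤ f y ↔ r x y :=
  @exists_embedding_tdim t (Fin n) (toPO r h)
    ⟨n, @nonempty_orderEmbedding_chain_pow t ht (Fin n) (toPO r h)⟩

theorem one_le_tdimRel {t n : ℕ} (ht : 2 ≤ t) (hn : 2 ≤ n) (r : Fin n → Fin n → Prop)
    (h : IsPartialOrder (Fin n) r) : 1 ≤ tdimRel t n r h := by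
  obtain ⟨f, hf⟩ := exists_embedding_tdimRel ht r h
  by_contra! hd
  have hall : ∀ x y, r x y := fun x y => (hf x y).1 fun i => absurd i.2 (by omega)
  have := h.antisymm (⟨0, by omega⟩ : Fin n) ⟨1, by omega⟩ (hall _ _) (hall _ _)
  simp at this

/-- There are at most `t ^ (d * n)` partial orders of `t`-dimension `d` on an `n`-set. -/
theorem card_tdimRel_eq_le {t n : ℕ} (ht : 2 ≤ t) (d : ℕ) :
    (Finset.univ.filter fun r : {r : Fin n → Fin n → Prop // IsPartialOrder (Fin n) r} =>
      tdimRel t n r.1 r.2 = d).card ≤ t ^ (d * n) := by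
  have hsub : ((Finset.univ.filter
      fun r : {r : Fin n → Fin n → Prop // IsPartialOrder (Fin n) r} =>
        tdimRel t n r.1 r.2 = d).image Subtype.val) ⊆
      (Finset.univ : Finset (Fin n → Fin d → Fin t)).image (fun f x y => f x ≤ f y) := by
    intro s hs
    obtain ⟨r, hr, rfl⟩ := Finset.mem_image.1 hs
    obtain rfl := (Finset.mem_filter.1 hr).2
    obtain ⟨f, hf⟩ := exists_embedding_tdimRel ht r.1 r.2
    exact Finset.mem_image.2 ⟨f, Finset.mem_univ _, by ext x y; exact hf x y⟩
  rw [← Finset.card_image_of_injective _ Subtype.val_injective]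
  refine (Finset.card_le_card hsub).trans (Finset.card_image_le.trans ?_)
  simp [pow_mul]

/-- A bipartite relation between the first `n / 2` and the remaining elements of `Fin n`,
together with equality. -/
def bipartiteRel (n : ℕ) (S : Set (Fin (n / 2) × Fin (n - n / 2))) (x y : Fin n) : Prop :=
  x = y ∨ ∃ p ∈ S, x.val = p.1.val ∧ y.val = n / 2 + p.2.val

theorem isPartialOrder_bipartiteRel (n : ℕ) (S : Set (Fin (n / 2) × Fin (n - n / 2))) :
    IsPartialOrder (Fin n) (bipartiteRel n S) where
  refl _ := Or.inl rfl
  trans := by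
    rintro x y z (rfl | ⟨p, hp, h1, h2⟩) (rfl | ⟨q, hq, h3, h4⟩)
    · exact Or.inl rfl
    · exact Or.inr ⟨q, hq, h3, h4⟩
    · exact Or.inr ⟨p, hp, h1, h2⟩
    · have := q.1.2
      omega
  antisymm := by
    rintro x y (rfl | ⟨p, hp, h1, h2⟩) (h | ⟨q, hq, h3, h4⟩)
    · rfl
    · rfl
    · exact h.symm
    · have := q.1.2
      omega

theorem bipartiteRel_iff {n : ℕ} (S : Set (Fin (n / 2) × Fin (n - n / 2)))
    (p : Fin (n / 2) × Fin (n - n / 2)) :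
    bipartiteRel n S ⟨p.1, by omega⟩ ⟨n / 2 + p.2, by omega⟩ ↔ p ∈ S := by
  refine ⟨?_, fun h => Or.inr ⟨p, h, rfl, rfl⟩⟩
  rintro (h | ⟨q, hq, h1, h2⟩)
  · have := p.1.2
    simp only [Fin.mk.injEq] at h
    omega
  · obtain rfl : p = q := Prod.ext (Fin.ext h1) (Fin.ext (by simpa using h2))
    exact hq

/-- There are at least `2 ^ ⌊n² / 4⌋` partial orders on an `n`-set. -/
theorem two_pow_le_card_partialOrder (n : ℕ) :
    2 ^ (n ^ 2 / 4) ≤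
      Fintype.card {r : Fin n → Fin n → Prop // IsPartialOrder (Fin n) r} := by
  have hinj : Function.Injective fun S : Set (Fin (n / 2) × Fin (n - n / 2)) =>
      (⟨bipartiteRel n S, isPartialOrder_bipartiteRel n S⟩ :
        {r : Fin n → Fin n → Prop // IsPartialOrder (Fin n) r}) := by
    intro S T h
    ext p
    rw [← bipartiteRel_iff S p, ← bipartiteRel_iff T p, Subtype.mk.inj h]
  have hcard := Fintype.card_le_of_injective _ hinj
  have hsq : n ^ 2 / 4 = n / 2 * (n - n / 2) := by
    rcases Nat.even_or_odd' n with ⟨k, rfl | rfl⟩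
    · have h1 : 2 * k / 2 = k := by omega
      have h2 : 2 * k - k = k := by omega
      rw [h1, h2, show (2 * k) ^ 2 = 4 * (k * k) by ring]
      omega
    · have h1 : (2 * k + 1) / 2 = k := by omega
      have h2 : 2 * k + 1 - k = k + 1 := by omega
      rw [h1, h2, show (2 * k + 1) ^ 2 = 4 * (k * (k + 1)) + 1 by ring]
      omega
  simpa [hsq] using hcard

theorem sum_exp_neg_tdimRel_le {t n : ℕ} (ht : 2 ≤ t) (hn : 2 ≤ n) :
    ∑ r : {r : Fin n → Fin n → Prop // IsPartialOrder (Fin n) r},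
      Real.exp (-(n * Real.log t * (tdimRel t n r.1 r.2 : ℝ))) ≤ n := by
  have ht0 : (0 : ℝ) < t := by positivity
  have hexp : ∀ d : ℕ, Real.exp (-(n * Real.log t * (d : ℝ))) = ((t : ℝ) ^ (d * n))⁻¹ := by
    intro d
    rw [Real.exp_neg, ← Real.exp_log (pow_pos ht0 (d * n)), Real.log_pow]
    push_cast
    ring_nf
  rw [← Finset.sum_fiberwise_of_maps_to (t := Finset.Icc 1 n)
    (g := fun r : {r : Fin n → Fin n → Prop // IsPartialOrder (Fin n) r} =>
      tdimRel t n r.1 r.2)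
    fun r _ => Finset.mem_Icc.2 ⟨one_le_tdimRel ht hn r.1 r.2, tdimRel_le ht r.1 r.2⟩]
  calc _ ≤ ∑ d ∈ Finset.Icc 1 n, (1 : ℝ) := Finset.sum_le_sum fun d _ => ?_
    _ = n := by simp
  rw [Finset.sum_congr rfl fun r hr => by rw [(Finset.mem_filter.1 hr).2, hexp d],
    Finset.sum_const, nsmul_eq_mul, ← div_eq_mul_inv, div_le_one (by positivity)]
  exact_mod_cast card_tdimRel_eq_le ht d

theorem le_mean_tdimRel {t n : ℕ} (ht : 2 ≤ t) (hn : 2 ≤ n) :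
    ((n ^ 2 / 4 : ℕ) : ℝ) / (n * Real.logb 2 t) - (⌈Real.logb t n⌉ : ℝ) / n ≤
      (∑ r : {r : Fin n → Fin n → Prop // IsPartialOrder (Fin n) r},
          (tdimRel t n r.1 r.2 : ℝ)) /
        (Fintype.card {r : Fin n → Fin n → Prop // IsPartialOrder (Fin n) r}) := by
  have hcard := two_pow_le_card_partialOrder n
  have : Nonempty {r : Fin n → Fin n → Prop // IsPartialOrder (Fin n) r} :=
    Fintype.card_pos_iff.1 (lt_of_lt_of_le (by positivity) hcard)
  have hmean := log_card_sub_log_le_mul_mean _ _ _ (sum_exp_neg_tdimRel_le ht hn)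
  have hlog := Real.log_le_log (by positivity)
    (show (2 : ℝ) ^ (n ^ 2 / 4) ≤
      (Fintype.card {r : Fin n → Fin n → Prop // IsPartialOrder (Fin n) r} : ℝ) from
      mod_cast hcard)
  rw [Real.log_pow] at hlog
  have hL : 0 < Real.log t := Real.log_pos (by exact_mod_cast ht)
  have h2 : 0 < Real.log 2 := Real.log_pos (by norm_num)
  have hn0 : (0 : ℝ) < n := by positivity
  have hceil : Real.log n ≤ Real.log t * ⌈Real.logb t n⌉ := by
    have := Int.le_ceil (Real.logb t n)
    rw [Real.logb, div_le_iff₀ hL] at this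
    rwa [mul_comm]
  have hlhs : ((n ^ 2 / 4 : ℕ) : ℝ) / (n * Real.logb 2 t) - (⌈Real.logb t n⌉ : ℝ) / n =
      (((n ^ 2 / 4 : ℕ) : ℝ) * Real.log 2 - Real.log t * ⌈Real.logb t n⌉) /
        (n * Real.log t) := by
    generalize (⌈Real.logb t n⌉ : ℝ) = c
    rw [Real.logb]
    field_simp
  rw [hlhs, div_le_iff₀' (by positivity)]
  linarith

end PaperLD

/-- For all `t ≥ 2` and `n ≥ 2`, the average of `dim_t` over all partial orders on an
`n`-set is at least `⌊n²/4⌋ / (n log t) − ⌈log_t n⌉ / n` (logs base 2); in particular for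
`t = 2` the average `2`-dimension is at least `⌊n²/4⌋ / n − ⌈log n⌉ / n`. -/
theorem stmt5 (t n : ℕ) (ht : 2 ≤ t) (hn : 2 ≤ n) :
    (((n ^ 2 / 4 : ℕ) : ℝ) / (n * Real.logb 2 t) - (⌈Real.logb t n⌉ : ℝ) / n ≤
      (∑ r : {r : Fin n → Fin n → Prop // IsPartialOrder (Fin n) r},
          (tdimRel t n r.1 r.2 : ℝ)) /
        (Fintype.card {r : Fin n → Fin n → Prop // IsPartialOrder (Fin n) r})) ∧
    (((n ^ 2 / 4 : ℕ) : ℝ) / n - (⌈Real.logb 2 n⌉ : ℝ) / n ≤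
      (∑ r : {r : Fin n → Fin n → Prop // IsPartialOrder (Fin n) r},
          (tdimRel 2 n r.1 r.2 : ℝ)) /
        (Fintype.card {r : Fin n → Fin n → Prop // IsPartialOrder (Fin n) r})) := by
  refine ⟨le_mean_tdimRel ht hn, ?_⟩
  simpa using le_mean_tdimRel le_rfl hn
end

section
/- For all integers n ≥ 2 and 1 ≤ ℓ < k ≤ n − 1, ldim(Q(n; ℓ, k)) ≥ log C(n,k) / log C(n,ℓ) − ( log C(n,k) / (log C(n,ℓ))² ) · ( log log C(n,ℓ) + log 12 ), where C(n,j) denotes the binomial coefficient n choose j. -/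
open scoped Classical

open PaperLD

namespace PaperLD

section PLE

variable {α : Type*} [PartialOrder α]

theorem PLE.before_iff (L : PLE α) (x y : α) :
    L.Before x y ↔ x ∈ L.toList ∧ y ∈ L.toList ∧ L.toList.idxOf x ≤ L.toList.idxOf y := by
  constructor
  · rintro ⟨i, j, hij, rfl, rfl⟩
    refine ⟨List.get_mem _ _, List.get_mem _ _, ?_⟩
    simpa [L.nodup.idxOf_getElem] using hij
  · rintro ⟨hx, hy, h⟩
    exact ⟨⟨_, List.idxOf_lt_length_of_mem hx⟩, ⟨_, List.idxOf_lt_length_of_mem hy⟩, h,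
      by simp, by simp⟩

theorem PLE.Before.trans {L : PLE α} {x y z : α} (hxy : L.Before x y) (hyz : L.Before y z) :
    L.Before x z := by
  rw [PLE.before_iff] at *
  exact ⟨hxy.1, hyz.2.1, hxy.2.2.trans hyz.2.2⟩

theorem PLE.Before.not_le {L : PLE α} {x y : α} (h : L.Before x y) (hne : x ≠ y) : ¬ y ≤ x := by
  obtain ⟨i, j, hij, rfl, rfl⟩ := h
  intro hle
  exact hne (by rw [le_antisymm hij (L.le_imp j i hle)])

/-- The two-element partial linear extension listing `x` before `y`. -/
def PLE.pair (x y : α) (h : ¬ y ≤ x) : PLE α where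
  toList := [x, y]
  nodup := by
    have : x ≠ y := fun e => h e.ge
    simpa using this
  le_imp i j hij := by
    fin_cases i <;> fin_cases j <;> simp_all

theorem PLE.pair_before (x y : α) (h : ¬ y ≤ x) : (PLE.pair x y h).Before x y :=
  ⟨(0 : Fin 2), (1 : Fin 2), Fin.zero_le (1 : Fin 2), rfl, rfl⟩

theorem exists_isLocalRealiser (α : Type*) [PartialOrder α] [Fintype α] :
    ∃ (N : ℕ) (F : Fin N → PLE α), IsLocalRealiser F := by
  let e := Fintype.equivFin {p : α × α // ¬ p.2 ≤ p.1}
  refine ⟨_, fun i => PLE.pair (e.symm i).1.1 (e.symm i).1.2 (e.symm i).2, fun x y h => ?_⟩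
  refine ⟨e ⟨(x, y), h⟩, ?_⟩
  simpa using PLE.pair_before x y h

theorem ldim_spec (α : Type*) [PartialOrder α] [Fintype α] :
    ∃ (N : ℕ) (F : Fin N → PLE α), IsLocalRealiser F ∧ ∀ x : α, mult F x ≤ ldim α := by
  obtain ⟨N, F, hF⟩ := exists_isLocalRealiser α
  have hne : {d | ∃ (N : ℕ) (F : Fin N → PLE α),
      IsLocalRealiser F ∧ ∀ x : α, mult F x ≤ d}.Nonempty :=
    ⟨N, N, F, hF, fun x => (Finset.card_filter_le _ _).trans (by simp)⟩
  exact Nat.sInf_mem hne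

/-- The pairs `(i, u)` such that `u ∈ U` is the first element of `U` listed after `x`
in the `i`-th partial linear extension. -/
noncomputable def nextElements {N : ℕ} (F : Fin N → PLE α) (U : Finset α) (x : α) :
    Finset (Fin N × α) :=
  (Finset.univ ×ˢ U).filter fun p => (F p.1).Before x p.2 ∧
    ∀ u ∈ U, (F p.1).Before x u → (F p.1).Before p.2 u

theorem card_nextElements_le {N : ℕ} (F : Fin N → PLE α) (U : Finset α) (x : α) :
    (nextElements F U x).card ≤ mult F x := by
  refine Finset.card_le_card_of_injOn Prod.fst ?_ ?_
  · intro p hp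
    simp only [nextElements, Finset.coe_filter, Set.mem_ofPred_eq] at hp
    simpa using (((F p.1).before_iff _ _).1 hp.2.1).1
  · rintro ⟨i, u⟩ hp ⟨j, v⟩ hq (rfl : i = j)
    simp only [nextElements, Finset.coe_filter, Set.mem_ofPred_eq, Finset.mem_product,
      Finset.mem_univ, true_and] at hp hq
    have huv := ((F i).before_iff _ _).1 (hp.2.2 v hq.1 hq.2.1)
    have hvu := ((F i).before_iff _ _).1 (hq.2.2 u hp.1 hp.2.1)
    have := (List.idxOf_inj huv.1).1 (le_antisymm huv.2.2 hvu.2.2)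
    rw [this]

theorem not_le_iff_nextElements {N : ℕ} {F : Fin N → PLE α} (hF : IsLocalRealiser F)
    {U : Finset α} {x u : α} (hx : x ∉ U) (hu : u ∈ U) :
    ¬ u ≤ x ↔ ∃ p ∈ nextElements F U x, (F p.1).Before p.2 u := by
  constructor
  · intro h
    obtain ⟨i, hi⟩ := hF x u h
    obtain ⟨v, hv, hmin⟩ := Finset.exists_min_image (U.filter fun v => (F i).Before x v)
      (fun v => (F i).toList.idxOf v) ⟨u, by simp [hu, hi]⟩
    rw [Finset.mem_filter] at hv
    have key : ∀ w ∈ U, (F i).Before x w → (F i).Before v w := fun w hw hxw =>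
      ((F i).before_iff _ _).2 ⟨(((F i).before_iff _ _).1 hv.2).2.1,
        (((F i).before_iff _ _).1 hxw).2.1, hmin w (Finset.mem_filter.2 ⟨hw, hxw⟩)⟩
    refine ⟨(i, v), ?_, key u hu hi⟩
    simp only [nextElements, Finset.mem_filter, Finset.mem_product, Finset.mem_univ, true_and]
    exact ⟨hv.1, hv.2, key⟩
  · rintro ⟨p, hp, hpu⟩
    rw [nextElements, Finset.mem_filter] at hp
    exact (hp.2.1.trans hpu).not_le fun e => hx (e ▸ hu)

theorem card_le_sum_choose {N d : ℕ} {F : Fin N → PLE α} (hF : IsLocalRealiser F)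
    (hd : ∀ x, mult F x ≤ d) {U V : Finset α} (hUV : ∀ x ∈ V, x ∉ U)
    (hV : ∀ x ∈ V, ∀ y ∈ V, (∀ u ∈ U, u ≤ x ↔ u ≤ y) → x = y) :
    V.card ≤ ∑ i ∈ Finset.range (d + 1), (d * U.card).choose i := by
  let P : Finset (Fin N × α) := (Finset.univ ×ˢ U).filter fun p => p.2 ∈ (F p.1).toList
  have hP : P.card ≤ d * U.card := by
    have : P.card = ∑ u ∈ U, mult F u := by
      simp only [P, mult, Finset.card_filter, Finset.sum_product_right]
    rw [this, mul_comm, ← smul_eq_mul]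
    exact Finset.sum_le_card_nsmul _ _ _ fun u _ => hd u
  calc V.card ≤ ((Finset.range (d + 1)).biUnion fun i => P.powersetCard i).card := by
        refine Finset.card_le_card_of_injOn (nextElements F U) ?_ ?_
        · intro x _
          simp only [Finset.coe_biUnion, Set.mem_iUnion, Finset.mem_coe, Finset.mem_range,
            Finset.mem_powersetCard]
          refine ⟨_, Nat.lt_succ_of_le ((card_nextElements_le F U x).trans (hd x)), ?_, rfl⟩
          intro p hp
          rw [nextElements, Finset.mem_filter] at hp
          exact Finset.mem_filter.2 ⟨hp.1, (((F p.1).before_iff _ _).1 hp.2.1).2.1⟩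
        · intro x hx y hy hxy
          refine hV x hx y hy fun u hu => not_iff_not.1 ?_
          rw [not_le_iff_nextElements hF (hUV x hx) hu,
            not_le_iff_nextElements hF (hUV y hy) hu, hxy]
    _ ≤ ∑ i ∈ Finset.range (d + 1), (P.powersetCard i).card := Finset.card_biUnion_le
    _ ≤ _ := Finset.sum_le_sum fun i _ => by
        rw [Finset.card_powersetCard]
        exact Nat.choose_le_choose i hP

end PLE

theorem sum_choose_mul_le {a : ℕ} (ha : 1 ≤ a) (d : ℕ) :
    ((∑ i ∈ Finset.range (d + 1), (d * a).choose i : ℕ) : ℝ) ≤ (a * Real.exp 1) ^ d := by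
  have ha0 : (0 : ℝ) < a := by exact_mod_cast ha
  have ha1 : (1 : ℝ) ≤ a := by exact_mod_cast ha
  have hda : d ≤ d * a := Nat.le_mul_of_pos_right d ha
  have hexp : ((1 : ℝ) + (a : ℝ)⁻¹) ^ (d * a) ≤ Real.exp 1 ^ d := by
    rw [mul_comm d a, pow_mul]
    gcongr
    calc ((1 : ℝ) + (a : ℝ)⁻¹) ^ a ≤ Real.exp ((a : ℝ)⁻¹) ^ a := by
          gcongr
          rw [add_comm]
          exact Real.add_one_le_exp _
      _ = Real.exp 1 := by
          rw [← Real.exp_nat_mul, mul_inv_cancel₀ ha0.ne']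
  calc ((∑ i ∈ Finset.range (d + 1), (d * a).choose i : ℕ) : ℝ)
      = ∑ i ∈ Finset.range (d + 1), ((d * a).choose i : ℝ) := by push_cast; rfl
    _ ≤ ∑ i ∈ Finset.range (d + 1), (a : ℝ) ^ d * ((a : ℝ)⁻¹ ^ i * ((d * a).choose i : ℝ)) := by
        refine Finset.sum_le_sum fun i hi => ?_
        have hid : i ≤ d := Nat.lt_succ_iff.1 (Finset.mem_range.1 hi)
        rw [← mul_assoc]
        refine le_mul_of_one_le_left (Nat.cast_nonneg _) ?_
        rw [inv_pow, ← div_eq_mul_inv, one_le_div (by positivity)]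
        exact pow_le_pow_right₀ ha1 hid
    _ ≤ ∑ i ∈ Finset.range (d * a + 1),
          (a : ℝ) ^ d * ((a : ℝ)⁻¹ ^ i * ((d * a).choose i : ℝ)) :=
        Finset.sum_le_sum_of_subset_of_nonneg
          (Finset.range_subset_range.2 (by omega)) fun _ _ _ => by positivity
    _ = (a : ℝ) ^ d * ((1 : ℝ) + (a : ℝ)⁻¹) ^ (d * a) := by
        rw [← Finset.mul_sum, add_comm (1 : ℝ), add_pow]
        simp
    _ ≤ (a * Real.exp 1) ^ d := by
        rw [mul_pow]
        gcongr

/-- The elements of cardinality `j` in `BoolLayers n ℓ k`. -/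
def layer (n ℓ k j : ℕ) : Finset (BoolLayers n ℓ k) :=
  Finset.univ.filter fun s => s.1.card = j

theorem card_layer {n ℓ k j : ℕ} (hj : j = ℓ ∨ j = k) : (layer n ℓ k j).card = n.choose j := by
  have : ((Finset.univ : Finset (Fin n)).powersetCard j).card = n.choose j := by simp
  rw [← this, ← Finset.card_map (Function.Embedding.subtype _)]
  congr 1
  ext s
  simp only [layer, Finset.mem_map, Finset.mem_filter, Finset.mem_univ, true_and,
    Finset.mem_powersetCard, Finset.subset_univ, Function.Embedding.subtype_apply]
  constructor
  · rintro ⟨t, ht, rfl⟩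
    exact ht
  · intro hs
    exact ⟨⟨s, hs ▸ hj⟩, hs, rfl⟩

theorem subset_of_forall_card_eq {α : Type*} {ℓ : ℕ} (hℓ : 1 ≤ ℓ) {s t : Finset α}
    (hs : ℓ ≤ s.card) (h : ∀ u : Finset α, u.card = ℓ → u ⊆ s → u ⊆ t) : s ⊆ t := by
  intro a ha
  obtain ⟨u, hau, hus, hu⟩ := Finset.exists_subsuperset_card_eq
    (Finset.singleton_subset_iff.2 ha) (by simpa using hℓ) hs
  exact h u hu hus (hau (Finset.mem_singleton_self a))

theorem choose_le_pow_ldim {n ℓ k : ℕ} (hℓ : 1 ≤ ℓ) (hℓk : ℓ < k) (hℓn : ℓ ≤ n) :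
    (n.choose k : ℝ) ≤ (n.choose ℓ * Real.exp 1) ^ ldim (BoolLayers n ℓ k) := by
  obtain ⟨N, F, hF, hd⟩ := ldim_spec (BoolLayers n ℓ k)
  have hcard := card_le_sum_choose (U := layer n ℓ k ℓ) (V := layer n ℓ k k) hF hd ?_ ?_
  · rw [card_layer (Or.inl rfl), card_layer (Or.inr rfl)] at hcard
    exact (Nat.cast_le.2 hcard).trans (sum_choose_mul_le (Nat.choose_pos hℓn) _)
  · intro x hx hx'
    simp only [layer, Finset.mem_filter, Finset.mem_univ, true_and] at hx hx'
    omega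
  · intro x hx y hy h
    simp only [layer, Finset.mem_filter, Finset.mem_univ, true_and] at hx hy h
    refine Subtype.ext (Finset.Subset.antisymm ?_ ?_)
    · exact subset_of_forall_card_eq hℓ (by omega) fun u hu hus =>
        (h ⟨u, Or.inl hu⟩ hu).1 hus
    · exact subset_of_forall_card_eq hℓ (by omega) fun u hu hus =>
        (h ⟨u, Or.inl hu⟩ hu).2 hus

theorem div_sub_div_sq_mul_le {a b c d e : ℝ} (ha : 0 < a) (hb : 0 ≤ b)
    (hd : 0 ≤ d) (he : c ≤ e) (h : b ≤ d * (a + c)) : b / a - b / a ^ 2 * e ≤ d := by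
  have h1 : b / a - b / a ^ 2 * e = b * (a - e) / a ^ 2 := by
    field_simp
  rw [h1, div_le_iff₀ (by positivity)]
  rcases le_total a c with hac | hac
  · nlinarith [mul_nonneg hb (sub_nonneg.2 (hac.trans he)), mul_nonneg hd (sq_nonneg a)]
  · nlinarith [mul_le_mul_of_nonneg_right h (sub_nonneg.2 hac),
      mul_nonneg hb (sub_nonneg.2 he), mul_nonneg hd (sq_nonneg c)]

end PaperLD

/-- For all `n ≥ 2` and `1 ≤ ℓ < k ≤ n − 1`,
`ldim(Q(n; ℓ, k)) ≥ log C(n,k)/log C(n,ℓ) − (log C(n,k)/(log C(n,ℓ))²)(log log C(n,ℓ) + log 12)`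
(logs base 2). -/
theorem stmt6 (n ℓ k : ℕ) (hn : 2 ≤ n) (hℓ : 1 ≤ ℓ) (hℓk : ℓ < k) (hk : k ≤ n - 1) :
    Real.logb 2 (n.choose k) / Real.logb 2 (n.choose ℓ) -
        Real.logb 2 (n.choose k) / (Real.logb 2 (n.choose ℓ)) ^ 2 *
          (Real.logb 2 (Real.logb 2 (n.choose ℓ)) + Real.logb 2 12) ≤
      (ldim (BoolLayers n ℓ k) : ℝ) := by
  have hA : 2 ≤ n.choose ℓ := by
    have h1 : n.choose ℓ ≠ 1 := by
      rw [Ne, Nat.choose_eq_one_iff]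
      omega
    have h0 : 0 < n.choose ℓ := Nat.choose_pos (by omega)
    omega
  have hB : 1 ≤ n.choose k := Nat.choose_pos (by omega)
  have hA' : (2 : ℝ) ≤ n.choose ℓ := by exact_mod_cast hA
  have hB' : (1 : ℝ) ≤ n.choose k := by exact_mod_cast hB
  have hlogA : 1 ≤ Real.logb 2 (n.choose ℓ) := by
    rw [Real.le_logb_iff_rpow_le (by norm_num) (by linarith)]
    simpa using hA'
  have hexp : Real.logb 2 (Real.exp 1) ≤ Real.logb 2 12 :=
    Real.logb_le_logb_of_le (by norm_num) (Real.exp_pos 1)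
      (by linarith [Real.exp_one_lt_d9])
  refine div_sub_div_sq_mul_le (c := Real.logb 2 (Real.exp 1)) (by linarith)
    (Real.logb_nonneg (by norm_num) hB')
    (Nat.cast_nonneg _)
    (by linarith [Real.logb_nonneg (b := 2) (by norm_num) hlogA]) ?_
  rw [← Real.logb_mul (by linarith) (Real.exp_pos 1).ne', ← Real.logb_pow]
  exact Real.logb_le_logb_of_le (by norm_num) (by linarith)
    (choose_le_pow_ldim hℓ hℓk (by omega))
end
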